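/- Let p₁, p₂, q be real numbers with 0 < p₁ ≤ 2/3, q = p₁/2, and p₂ ≥ 4p₁. Then: (a) there is no real δ with p₂q + 2q² − δ(p₂ + 4q) < 0 and 5q² − 6δq > 0, so no threshold separates the expected Tectonic scores of inside-B₁ edges from those of cross-block edges; and (b) (3p₁² − 2p₁ + 3q² − 2q) − (3p₁q + 3p₂q − p₁ − p₂ − 2q) > 0, so some threshold separates the expected TW scores of inside-B₁ edges from those of cross-block edges. Hence, in expectation, TW recovers the two blocks while Tectonic fails. -/

import Mathlib

/-- With `0 < p₁ ≤ 2/3`, `q = p₁/2`, `p₂ ≥ 4p₁`: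
(a) no threshold `δ` separates the expected Tectonic scores (cross-block
negative and inside-`B₁` positive), and
(b) the expected TW score inside `B₁` strictly exceeds the expected
cross-block TW score. Hence TW recovers the two blocks in expectation while
Tectonic fails. -/
theorem tw_succeeds_tectonic_fails (p₁ p₂ q : ℝ) (hp₁ : 0 < p₁) (hp₁' : p₁ ≤ 2 / 3)
    (hq : q = p₁ / 2) (hp₂ : 4 * p₁ ≤ p₂) :
    (¬ ∃ δ : ℝ, p₂ * q + 2 * q ^ 2 - δ * (p₂ + 4 * q) < 0 ∧
        5 * q ^ 2 - 6 * δ * q > 0) ∧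
      (3 * p₁ ^ 2 - 2 * p₁ + 3 * q ^ 2 - 2 * q) -
          (3 * p₁ * q + 3 * p₂ * q - p₁ - p₂ - 2 * q) > 0 := by
  subst hq
  refine ⟨?_, ?_⟩
  · rintro ⟨δ, hcross, hin⟩
    have hδ : δ < 5 * p₁ / 12 := by
      by_contra! h
      nlinarith [mul_le_mul_of_nonneg_right h hp₁.le]
    have hdeg : δ * (p₂ + 2 * p₁) < 5 * p₁ / 12 * (p₂ + 2 * p₁) :=
      mul_lt_mul_of_pos_right hδ (by linarith)
    nlinarith [mul_le_mul_of_nonneg_left hp₂ hp₁.le]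
  · have h : 0 ≤ (1 - 3 / 2 * p₁) * (p₂ - 4 * p₁) :=
      mul_nonneg (by linarith) (by linarith)
    have hpos : 0 < p₁ * (1 - 5 / 4 * p₁) := mul_pos hp₁ (by linarith)
    linarith
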